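/- Let φ be a locally Hölder potential on X = [0,1]∖ℚ with φ ≤ 0 and P(φ) = 0, μ_φ its Gibbs measure for the Gauss map, ψ = −log|T′|, and λ = −∫ψ dμ_φ the Lyapunov exponent. Suppose {t ∈ ℝ : P(tψ + φ) < ∞} contains a neighbourhood of the origin. Then for every ε > 0 there exist δ > 0 and n₁ ∈ ℕ such that for all n ≥ n₁, μ_φ({x : |S_nψ(x) + nλ| ≥ nε}) ≤ e^{−nδ}. -/

import Mathlib

open MeasureTheory Filter Set Topology
open scoped ENNReal NNReal Classical Real

noncomputable section

/-- The Gauss map `T(x) = 1/x mod 1`. -/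
def gaussMap (x : ℝ) : ℝ := Int.fract x⁻¹

/-- The space `X = [0,1] ∖ ℚ` of irrational numbers in the unit interval. -/
def gaussSet : Set ℝ := {x | x ∈ Set.Icc (0:ℝ) 1 ∧ Irrational x}

/-- The first continued fraction digit `a₁(x) = ⌊1/x⌋`. -/
def cfDigit1 (x : ℝ) : ℕ := ⌊x⁻¹⌋₊

/-- The `(i+1)`-th continued fraction digit `a_{i+1}(x) = a₁(Tⁱ x)`. -/
def cfDigit (i : ℕ) (x : ℝ) : ℕ := cfDigit1 (gaussMap^[i] x)

/-- The inverse branch `T_a(x) = 1/(x+a)` of the Gauss map. -/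
def invBranch1 (a : ℕ) (x : ℝ) : ℝ := (x + (a : ℝ))⁻¹

/-- The composed inverse branch `T_𝐚 = T_{a₁} ∘ ⋯ ∘ T_{aₙ}` for `𝐚 = [a₁,…,aₙ]`. -/
def invBranch (l : List ℕ) (x : ℝ) : ℝ := l.foldr invBranch1 x

/-- The cylinder set `I_𝐚` of points of `X` whose first digits are given by `𝐚`. -/
def cylinder (l : List ℕ) : Set ℝ :=
  {x | x ∈ gaussSet ∧ ∀ i : Fin l.length, cfDigit i.1 x = l.get i}

/-- The Birkhoff sum `S_n φ = ∑_{k<n} φ ∘ T^k`. -/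
def birkhoff (φ : ℝ → ℝ) (n : ℕ) (x : ℝ) : ℝ :=
  ∑ k ∈ Finset.range n, φ (gaussMap^[k] x)

/-- The pair `(pₙ(𝐚), qₙ(𝐚))` of numerator and denominator (continuant) of the
finite continued fraction `[a₁,…,aₙ] = pₙ/qₙ`. -/
def contPQ : List ℕ → ℕ × ℕ
  | [] => (0, 1)
  | a :: l => ((contPQ l).2, a * (contPQ l).2 + (contPQ l).1)

/-- The continuant `qₙ(𝐚)`, the denominator of `[a₁,…,aₙ]` in lowest terms. -/
def contQ (l : List ℕ) : ℕ := (contPQ l).2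

/-- Words of length `n` with digits in `ℕ = {1,2,…}`. -/
def Word (n : ℕ) : Type := {l : List ℕ // l.length = n ∧ ∀ a ∈ l, 0 < a}

/-- The periodic point `𝐚^∞` with periodic continued fraction expansion repeating `𝐚`. -/
def periodicPoint (l : List ℕ) : ℝ :=
  limUnder atTop fun k : ℕ => invBranch (List.flatten (List.replicate k l)) (1/2 : ℝ)

/-- The `n`-th partition sum `∑_{𝐚 ∈ ℕⁿ} exp(S_nφ(𝐚^∞))` appearing in the pressure. -/
def partSum (φ : ℝ → ℝ) (n : ℕ) : ℝ≥0∞ :=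
  ∑' l : Word n, ENNReal.ofReal (Real.exp (birkhoff φ n (periodicPoint l.1)))

/-- `φ` has (finite) pressure `P(φ) = p`, i.e. `(1/n) log ∑_{𝐚∈ℕⁿ} exp(S_nφ(𝐚^∞)) → p`. -/
def HasPressure (φ : ℝ → ℝ) (p : ℝ) : Prop :=
  (∀ n : ℕ, 0 < n → partSum φ n ≠ ⊤) ∧
    Tendsto (fun n : ℕ => Real.log (partSum φ n).toReal / (n : ℝ)) atTop (𝓝 p)

/-- The pressure of `φ` is finite: `P(φ) < ∞`. -/
def PressureFinite (φ : ℝ → ℝ) : Prop := ∃ p : ℝ, HasPressure φ p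

/-- `φ` is locally Hölder: oscillation on `n`-cylinders decays geometrically. -/
def LocHolder (φ : ℝ → ℝ) : Prop :=
  ∃ C > (0:ℝ), ∃ θ ∈ Set.Ioo (0:ℝ) 1, ∀ l : List ℕ, l ≠ [] → (∀ a ∈ l, 0 < a) →
    ∀ x ∈ cylinder l, ∀ y ∈ cylinder l, |φ x - φ y| ≤ C * θ ^ l.length

/-- The normalization `𝓛_φ 1 = 1` of the Ruelle transfer operator of `φ`. -/
def TransferNormalized (φ : ℝ → ℝ) : Prop :=
  ∀ x ∈ gaussSet, ∑' a : ℕ+, Real.exp (φ (invBranch1 (a : ℕ) x)) = 1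

/-- `μ` is invariant under the Gauss map. -/
def GaussInvariant (μ : Measure ℝ) : Prop :=
  ∀ s : Set ℝ, MeasurableSet s → μ (gaussMap ⁻¹' s) = μ s

/-- The Gibbs property for the potential `φ` (with `P(φ) = 0`):
`C⁻¹ e^{S_nφ(T_𝐚 x)} ≤ μ(I_𝐚) ≤ C e^{S_nφ(T_𝐚 x)}`. -/
def IsGibbs (φ : ℝ → ℝ) (μ : Measure ℝ) : Prop :=
  ∃ C : ℝ, 1 ≤ C ∧ ∀ l : List ℕ, l ≠ [] → (∀ a ∈ l, 0 < a) → ∀ x ∈ gaussSet,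
    C⁻¹ * Real.exp (birkhoff φ l.length (invBranch l x)) ≤ (μ (cylinder l)).toReal ∧
      (μ (cylinder l)).toReal ≤ C * Real.exp (birkhoff φ l.length (invBranch l x))

/-- The Kolmogorov–Sinai entropy of `μ`:
`h = lim (1/n) ∑_{𝐚∈ℕⁿ} -μ(I_𝐚) log μ(I_𝐚)`. -/
def HasEntropy (μ : Measure ℝ) (h : ℝ) : Prop :=
  Tendsto (fun n : ℕ => (∑' l : Word n, Real.negMulLog (μ (cylinder l.1)).toReal) / (n : ℝ))
    atTop (𝓝 h)

/-- `log |T'| (x) = log (1/x²)` for the Gauss map. -/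
def logAbsDerivGauss (x : ℝ) : ℝ := Real.log (1 / x ^ 2)

/-- The observable `ψ = -log |T'|`. -/
def gaussPsi (x : ℝ) : ℝ := -Real.log (1 / x ^ 2)

/-- The Lyapunov exponent `λ_μ = ∫ log|T'| dμ`. -/
def lyapunov (μ : Measure ℝ) : ℝ := ∫ x, logAbsDerivGauss x ∂μ

/-- The polynomial tail condition `μ({x : a₁(x) ≥ n}) = O(n^{-δ})`. -/
def PolyTail (μ : Measure ℝ) : Prop :=
  ∃ δ > (0:ℝ), ∃ K : ℝ, ∀ n : ℕ, 0 < n →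
    (μ {x | x ∈ gaussSet ∧ n ≤ cfDigit1 x}).toReal ≤ K * (n : ℝ) ^ (-δ)

/-- The Fourier transform `μ̂(ξ) = ∫ e^{-2πiξx} dμ(x)`. -/
def muFourier (μ : Measure ℝ) (ξ : ℝ) : ℂ :=
  ∫ x, Complex.exp (-(2 * Real.pi * ξ * x : ℝ) * Complex.I) ∂μ

/-- A sequence `u` equidistributes modulo 1. -/
def EquidistributedMod1 (u : ℕ → ℝ) : Prop :=
  ∀ a b : ℝ, 0 ≤ a → a ≤ b → b ≤ 1 →
    Tendsto (fun N : ℕ =>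
        (((Finset.range N).filter fun k => Int.fract (u k) ∈ Set.Ico a b).card : ℝ) / (N : ℝ))
      atTop (𝓝 (b - a))

/-- The set `B(𝒜)` of `𝒜`-badly approximable numbers: all digits lie in `𝒜`. -/
def badSet (A : Finset ℕ) : Set ℝ := {x | x ∈ gaussSet ∧ ∀ i : ℕ, cfDigit i x ∈ A}

/-- Locally Hölder on the subsystem `B(𝒜)`. -/
def LocHolderOn (A : Finset ℕ) (φ : ℝ → ℝ) : Prop :=
  ∃ C > (0:ℝ), ∃ θ ∈ Set.Ioo (0:ℝ) 1, ∀ l : List ℕ, l ≠ [] → (∀ a ∈ l, a ∈ A) →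
    ∀ x ∈ cylinder l ∩ badSet A, ∀ y ∈ cylinder l ∩ badSet A,
      |φ x - φ y| ≤ C * θ ^ l.length

/-- The Gibbs property for the Gauss map restricted to `B(𝒜)`. -/
def IsGibbsOn (A : Finset ℕ) (φ : ℝ → ℝ) (μ : Measure ℝ) : Prop :=
  ∃ C : ℝ, 1 ≤ C ∧ ∀ l : List ℕ, l ≠ [] → (∀ a ∈ l, a ∈ A) → ∀ x ∈ badSet A,
    C⁻¹ * Real.exp (birkhoff φ l.length (invBranch l x)) ≤ (μ (cylinder l)).toReal ∧
      (μ (cylinder l)).toReal ≤ C * Real.exp (birkhoff φ l.length (invBranch l x))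

/-- The `n`-regular set `A_n(ε)` of the large deviation decomposition. -/
def regSet (φ : ℝ → ℝ) (lam s ε : ℝ) (n : ℕ) : Set ℝ :=
  {x | |birkhoff gaussPsi n x / (n : ℝ) + lam| < ε ∧
       |birkhoff φ n x / birkhoff gaussPsi n x - s| < ε}

/-- The collection `𝓡ₙ` of `n`-regular words. -/
def regWords (φ : ℝ → ℝ) (lam s ε : ℝ) (n : ℕ) : Set (List ℕ) :=
  {l | l.length = n ∧ (∀ a ∈ l, 0 < a) ∧
       ∀ k : ℕ, n / 2 ≤ k → k ≤ n → cylinder (l.take k) ⊆ regSet φ lam s ε k}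

/-- The union `Rₙ` of the `n`-regular cylinders. -/
def regUnion (φ : ℝ → ℝ) (lam s ε : ℝ) (n : ℕ) : Set ℝ :=
  ⋃ l ∈ regWords φ lam s ε n, cylinder l

end

/-- Mean ergodic theorem for a centred observable. -/
theorem Ergodic.tendsto_eLpNorm_birkhoffAverage {Ω : Type*} [MeasurableSpace Ω] {μ : Measure Ω}
    {T : Ω → Ω} (hT : Ergodic T μ) {f : Ω → ℝ} (hf : MemLp f 2 μ) (h0 : ∫ x, f x ∂μ = 0) :
    Tendsto (fun n => eLpNorm (birkhoffAverage ℝ T f n) 2 μ) atTop (𝓝 0) := by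
  have hm := hT.toMeasurePreserving
  set U : Lp ℝ 2 μ →L[ℝ] Lp ℝ 2 μ :=
    (Lp.compMeasurePreservingₗᵢ ℝ T hm).toContinuousLinearMap with hU
  have hUn : ‖U‖ ≤ 1 := LinearIsometry.norm_toContinuousLinearMap_le _
  have hlim := U.tendsto_birkhoffAverage_orthogonalProjection hUn (hf.toLp f)
  have hzero : (U.eqLocus (1 : Lp ℝ 2 μ →L[ℝ] Lp ℝ 2 μ)).orthogonalProjectionOnto (hf.toLp f)
      = 0 := by
    rw [Submodule.orthogonalProjectionOnto_eq_zero_iff, Submodule.mem_orthogonal]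
    intro y hy
    have hy' : U y = y := by simpa using hy
    have hyT : (y : Ω → ℝ) ∘ T =ᵐ[μ] y := by
      have := Lp.coeFn_compMeasurePreserving y hm
      exact this.symm.trans (by rw [show Lp.compMeasurePreserving T hm y = U y from rfl, hy'])
    obtain ⟨c, hc⟩ := hT.ae_eq_const_of_ae_eq_comp_ae (Lp.aestronglyMeasurable y) hyT
    rw [L2.inner_def]
    have : (fun a => inner ℝ (y a) (hf.toLp f a)) =ᵐ[μ] fun a => f a * c := by
      filter_upwards [hc, hf.coeFn_toLp] with a h1 h2
      simp [h1, h2]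
    rw [integral_congr_ae this, integral_mul_const, h0, zero_mul]
  rw [hzero] at hlim
  have hit : ∀ n, ∃ hn : MemLp (f ∘ T^[n]) 2 μ, U^[n] (hf.toLp f) = hn.toLp _ := by
    intro n
    refine ⟨hf.comp_measurePreserving (hm.iterate n), ?_⟩
    have : (U : Lp ℝ 2 μ → Lp ℝ 2 μ) = Lp.compMeasurePreserving T hm := rfl
    rw [this, Lp.compMeasurePreserving_iterate, Lp.toLp_compMeasurePreserving]
  have hsum : ∀ n, ⇑(birkhoffSum U (_root_.id : Lp ℝ 2 μ → Lp ℝ 2 μ) n (hf.toLp f))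
      =ᵐ[μ] birkhoffSum T f n := by
    intro n
    induction n with
    | zero => simpa using Lp.coeFn_zero ℝ 2 μ
    | succ n ih =>
      obtain ⟨hn, h⟩ := hit n
      rw [birkhoffSum_succ, _root_.id, h]
      filter_upwards [ih, hn.coeFn_toLp, Lp.coeFn_add (birkhoffSum U
        (_root_.id : Lp ℝ 2 μ → Lp ℝ 2 μ) n (hf.toLp f)) (hn.toLp _)] with x h1 h2 h3
      rw [h3, Pi.add_apply, h1, h2, birkhoffSum_succ, Function.comp_apply]
  have hae : ∀ n, birkhoffAverage ℝ T f n
      =ᵐ[μ] ⇑(birkhoffAverage ℝ U (_root_.id : Lp ℝ 2 μ → Lp ℝ 2 μ) n (hf.toLp f)) := by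
    intro n
    have h2 := Lp.coeFn_smul ((n : ℝ)⁻¹)
      (birkhoffSum U (_root_.id : Lp ℝ 2 μ → Lp ℝ 2 μ) n (hf.toLp f))
    filter_upwards [hsum n, h2] with x h1 h2
    rw [birkhoffAverage, birkhoffAverage, h2, Pi.smul_apply, h1]
  have : ∀ n, eLpNorm (birkhoffAverage ℝ T f n) 2 μ
      = ‖birkhoffAverage ℝ U (_root_.id : Lp ℝ 2 μ → Lp ℝ 2 μ) n (hf.toLp f)‖ₑ := by
    intro n
    rw [Lp.enorm_def]
    exact eLpNorm_congr_ae (hae n)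
  simp_rw [this]
  simpa using hlim.enorm

/-- The exponential moment of a Birkhoff sum. -/
noncomputable def birkhoffExpMoment {Ω : Type*} [MeasurableSpace Ω] (μ : Measure Ω) (T : Ω → Ω)
    (f : Ω → ℝ) (t : ℝ) (n : ℕ) : ℝ≥0∞ :=
  ∫⁻ x, ENNReal.ofReal (Real.exp (t * birkhoffSum T f n x)) ∂μ

section LargeDeviations

variable {Ω : Type*} [MeasurableSpace Ω] {μ : Measure Ω} {T : Ω → Ω} {f : Ω → ℝ}

theorem measurable_birkhoffSum (hT : Measurable T) (hf : Measurable f) (n : ℕ) :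
    Measurable (birkhoffSum T f n) := by
  unfold birkhoffSum
  exact Finset.measurable_fun_sum _ fun k _ => hf.comp (hT.iterate k)

theorem birkhoffExpMoment_zero_right [IsProbabilityMeasure μ] (t : ℝ) :
    birkhoffExpMoment μ T f t 0 = 1 := by
  simp [birkhoffExpMoment]

theorem birkhoffExpMoment_mul_add_le {K : ℝ≥0∞} {t : ℝ}
    (hK : ∀ n m, birkhoffExpMoment μ T f t (n + m)
      ≤ K * birkhoffExpMoment μ T f t n * birkhoffExpMoment μ T f t m) (k n r : ℕ) :
    birkhoffExpMoment μ T f t (k * n + r)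
      ≤ (K * birkhoffExpMoment μ T f t n) ^ k * birkhoffExpMoment μ T f t r := by
  induction k with
  | zero => simp
  | succ k ih =>
    calc birkhoffExpMoment μ T f t ((k + 1) * n + r)
        = birkhoffExpMoment μ T f t (n + (k * n + r)) := by congr 1; ring
      _ ≤ K * birkhoffExpMoment μ T f t n * birkhoffExpMoment μ T f t (k * n + r) := hK _ _
      _ ≤ K * birkhoffExpMoment μ T f t n *
          ((K * birkhoffExpMoment μ T f t n) ^ k * birkhoffExpMoment μ T f t r) := by gcongr
      _ = _ := by ring

theorem birkhoffExpMoment_le_pow [IsProbabilityMeasure μ] {K : ℝ≥0∞} {t : ℝ}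
    (hK : ∀ n m, birkhoffExpMoment μ T f t (n + m)
      ≤ K * birkhoffExpMoment μ T f t n * birkhoffExpMoment μ T f t m) (n : ℕ) :
    birkhoffExpMoment μ T f t n ≤ (K * birkhoffExpMoment μ T f t 1) ^ n := by
  simpa [birkhoffExpMoment_zero_right] using birkhoffExpMoment_mul_add_le hK n 1 0

theorem birkhoffExpMoment_le_rpow [IsProbabilityMeasure μ] (hT : Measurable T)
    (hf : Measurable f) {t s : ℝ} (ht : 0 < t) (hts : t ≤ s) (n : ℕ) :
    birkhoffExpMoment μ T f t n ≤ birkhoffExpMoment μ T f s n ^ (t / s) := by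
  have hm : Measurable fun x => Real.exp (birkhoffSum T f n x) :=
    (measurable_birkhoffSum hT hf n).exp
  have key := eLpNorm'_le_eLpNorm'_of_exponent_le ht hts μ hm.aestronglyMeasurable
  have hZ : ∀ u : ℝ, 0 ≤ u → ∫⁻ x, ‖Real.exp (birkhoffSum T f n x)‖ₑ ^ u ∂μ
      = birkhoffExpMoment μ T f u n := by
    intro u hu
    refine lintegral_congr fun x => ?_
    rw [Real.enorm_eq_ofReal (Real.exp_pos _).le, ENNReal.ofReal_rpow_of_nonneg
      (Real.exp_pos _).le hu, ← Real.exp_mul, mul_comm]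
  rw [eLpNorm'_eq_lintegral_enorm, eLpNorm'_eq_lintegral_enorm, hZ t ht.le,
    hZ s (ht.le.trans hts)] at key
  have := ENNReal.rpow_le_rpow key ht.le
  rwa [← ENNReal.rpow_mul, ← ENNReal.rpow_mul, one_div_mul_cancel ht.ne', ENNReal.rpow_one,
    one_div_mul_eq_div] at this

theorem birkhoffExpMoment_div_le [IsProbabilityMeasure μ] (hT : Measurable T)
    (hf : Measurable f) {K : ℝ≥0∞} {s M : ℝ} (hM : 0 < M)
    (hK : ∀ n m, birkhoffExpMoment μ T f s (n + m)
      ≤ K * birkhoffExpMoment μ T f s n * birkhoffExpMoment μ T f s m) {n : ℕ} (hn : 0 < n)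
    (hMn : M / n ≤ s) :
    birkhoffExpMoment μ T f (M / n) n ≤ (K * birkhoffExpMoment μ T f s 1) ^ (M / s) := by
  have hn' : (0 : ℝ) < n := by exact_mod_cast hn
  have hpos : 0 < M / n := by positivity
  have hs : 0 < s := hpos.trans_le hMn
  calc birkhoffExpMoment μ T f (M / n) n
      ≤ birkhoffExpMoment μ T f s n ^ (M / n / s) := birkhoffExpMoment_le_rpow hT hf hpos hMn n
    _ ≤ ((K * birkhoffExpMoment μ T f s 1) ^ n) ^ (M / n / s) := by
        gcongr
        exact birkhoffExpMoment_le_pow hK n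
    _ = _ := by
        rw [← ENNReal.rpow_natCast, ← ENNReal.rpow_mul]
        congr 1
        field_simp

theorem exp_mul_le_add {M η u : ℝ} (hM : 0 ≤ M) (hη : 0 < η) :
    Real.exp (M * u) ≤ Real.exp (M * η) + η⁻¹ * (|u| * Real.exp (M * u)) := by
  rcases le_or_gt u η with h | h
  · have : Real.exp (M * u) ≤ Real.exp (M * η) := by gcongr
    have : 0 ≤ η⁻¹ * (|u| * Real.exp (M * u)) := by positivity
    linarith
  · have h1 : 1 ≤ η⁻¹ * |u| := by
      rw [inv_mul_eq_div, one_le_div hη]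
      exact h.le.trans (le_abs_self u)
    have := mul_le_mul_of_nonneg_right h1 (Real.exp_pos (M * u)).le
    linarith [Real.exp_pos (M * η)]

theorem birkhoffExpMoment_div_le_add [IsProbabilityMeasure μ] (hT : Measurable T)
    (hf : Measurable f) {M η : ℝ} (hM : 0 ≤ M) (hη : 0 < η) (n : ℕ) :
    birkhoffExpMoment μ T f (M / n) n ≤ ENNReal.ofReal (Real.exp (M * η)) +
      ENNReal.ofReal η⁻¹ * (eLpNorm (birkhoffAverage ℝ T f n) 2 μ *
        birkhoffExpMoment μ T f (2 * M / n) n ^ (1 / 2 : ℝ)) := by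
  have hS := measurable_birkhoffSum hT hf n
  have hA : Measurable (birkhoffAverage ℝ T f n) := hS.const_smul (n : ℝ)⁻¹
  have hM' : ∀ x, M / n * birkhoffSum T f n x = M * birkhoffAverage ℝ T f n x := by
    intro x
    simp only [birkhoffAverage, smul_eq_mul]
    ring
  have hexp : Measurable fun x => ENNReal.ofReal (Real.exp (M * birkhoffAverage ℝ T f n x)) :=
    ((hA.const_mul M).exp).ennreal_ofReal
  have hHolder := ENNReal.lintegral_mul_le_Lp_mul_Lq μ Real.HolderConjugate.two_two
    (hA.enorm).aemeasurable hexp.aemeasurable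
  have h2 : ∫⁻ x, ENNReal.ofReal (Real.exp (M * birkhoffAverage ℝ T f n x)) ^ (2 : ℝ) ∂μ
      = birkhoffExpMoment μ T f (2 * M / n) n := by
    refine lintegral_congr fun x => ?_
    rw [ENNReal.ofReal_rpow_of_nonneg (Real.exp_pos _).le (by norm_num), ← Real.exp_mul, ← hM' x]
    congr 2
    ring
  have h3 : (∫⁻ x, ‖birkhoffAverage ℝ T f n x‖ₑ ^ (2 : ℝ) ∂μ) ^ (1 / 2 : ℝ)
      = eLpNorm (birkhoffAverage ℝ T f n) 2 μ := by
    rw [eLpNorm_eq_lintegral_rpow_enorm_toReal (by norm_num) (by norm_num)]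
    simp
  rw [h2, h3] at hHolder
  calc birkhoffExpMoment μ T f (M / n) n
      ≤ ∫⁻ x, (ENNReal.ofReal (Real.exp (M * η)) + ENNReal.ofReal η⁻¹ *
        (‖birkhoffAverage ℝ T f n x‖ₑ *
          ENNReal.ofReal (Real.exp (M * birkhoffAverage ℝ T f n x)))) ∂μ := by
        refine lintegral_mono fun x => ?_
        rw [hM' x, Real.enorm_eq_ofReal_abs, ← ENNReal.ofReal_mul (abs_nonneg _),
          ← ENNReal.ofReal_mul (by positivity), ← ENNReal.ofReal_add (by positivity)
            (by positivity)]
        exact ENNReal.ofReal_le_ofReal (exp_mul_le_add hM hη)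
    _ = ENNReal.ofReal (Real.exp (M * η)) + ENNReal.ofReal η⁻¹ *
        ∫⁻ x, ‖birkhoffAverage ℝ T f n x‖ₑ *
          ENNReal.ofReal (Real.exp (M * birkhoffAverage ℝ T f n x)) ∂μ := by
        rw [lintegral_add_left measurable_const, lintegral_const, measure_univ, mul_one,
          lintegral_const_mul' _ _ ENNReal.ofReal_ne_top]
    _ ≤ _ := by
        gcongr
        exact hHolder

theorem eventually_birkhoffExpMoment_div_lt [IsProbabilityMeasure μ] (hT : Ergodic T μ)
    (hf : Measurable f) (hf2 : MemLp f 2 μ) (h0 : ∫ x, f x ∂μ = 0) {K : ℝ≥0∞} (hKtop : K ≠ ⊤)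
    {s M : ℝ} (hs : 0 < s) (hM : 0 < M) (hfin : birkhoffExpMoment μ T f s 1 ≠ ⊤)
    (hK : ∀ n m, birkhoffExpMoment μ T f s (n + m)
      ≤ K * birkhoffExpMoment μ T f s n * birkhoffExpMoment μ T f s m) :
    ∀ᶠ n : ℕ in atTop, birkhoffExpMoment μ T f (M / n) n < ENNReal.ofReal (Real.exp 1) := by
  set η : ℝ := (2 * M)⁻¹ with hηdef
  have hη : 0 < η := by positivity
  have hMη : M * η = 1 / 2 := by rw [hηdef]; field_simp
  set R : ℝ≥0∞ := ((K * birkhoffExpMoment μ T f s 1) ^ (2 * M / s)) ^ (1 / 2 : ℝ) with hR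
  have hRtop : R ≠ ⊤ := by
    refine ENNReal.rpow_ne_top_of_nonneg (by norm_num) ?_
    exact ENNReal.rpow_ne_top_of_nonneg (by positivity) (ENNReal.mul_ne_top hKtop hfin)
  have hlim : Tendsto (fun n : ℕ => ENNReal.ofReal (Real.exp (M * η)) +
      ENNReal.ofReal η⁻¹ * (eLpNorm (birkhoffAverage ℝ T f n) 2 μ * R)) atTop
      (𝓝 (ENNReal.ofReal (Real.exp (M * η)) + ENNReal.ofReal η⁻¹ * (0 * R))) := by
    refine tendsto_const_nhds.add (ENNReal.Tendsto.const_mul ?_ (Or.inr ENNReal.ofReal_ne_top))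
    exact ENNReal.Tendsto.mul_const (hT.tendsto_eLpNorm_birkhoffAverage hf2 h0) (Or.inr hRtop)
  have hlt : ENNReal.ofReal (Real.exp (M * η)) + ENNReal.ofReal η⁻¹ * (0 * R)
      < ENNReal.ofReal (Real.exp 1) := by
    rw [zero_mul, mul_zero, add_zero, ENNReal.ofReal_lt_ofReal_iff (Real.exp_pos _), hMη]
    gcongr
    norm_num
  filter_upwards [hlim.eventually_lt_const hlt, eventually_gt_atTop 0,
    tendsto_natCast_atTop_atTop.eventually_ge_atTop (2 * M / s)] with n h1 hn h2
  refine lt_of_le_of_lt ?_ h1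
  have hn' : (0 : ℝ) < n := by exact_mod_cast hn
  refine (birkhoffExpMoment_div_le_add hT.measurable hf hM.le hη n).trans ?_
  gcongr
  rw [hR]
  gcongr
  refine birkhoffExpMoment_div_le hT.measurable hf (by positivity) hK hn ?_
  rw [div_le_iff₀ hn']
  rw [div_le_iff₀ hs] at h2
  linarith

/-- One-sided exponential large deviations for a centred observable with submultiplicative
exponential moments over an ergodic transformation. -/
theorem Ergodic.measure_birkhoffSum_ge_le [IsProbabilityMeasure μ] (hT : Ergodic T μ)
    (hf : Measurable f) (hf2 : MemLp f 2 μ) (h0 : ∫ x, f x ∂μ = 0) {κ s : ℝ} (hκ : 0 ≤ κ)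
    (hs : 0 < s) (hfin : birkhoffExpMoment μ T f s 1 ≠ ⊤)
    (hK : ∀ t ∈ Set.Ioc 0 s, ∀ n m, birkhoffExpMoment μ T f t (n + m)
      ≤ ENNReal.ofReal (Real.exp κ) * birkhoffExpMoment μ T f t n * birkhoffExpMoment μ T f t m)
    {ε : ℝ} (hε : 0 < ε) :
    ∃ δ > (0 : ℝ), ∃ B : ℝ≥0∞, B ≠ ⊤ ∧ ∀ N : ℕ,
      μ {x | N * ε ≤ birkhoffSum T f N x} ≤ B * ENNReal.ofReal (Real.exp (-(N * δ))) := by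
  set M : ℝ := (κ + 2) / ε with hMdef
  have hM : 0 < M := by positivity
  have hMε : M * ε = κ + 2 := by rw [hMdef]; field_simp
  obtain ⟨n, hZ, hn, hns⟩ := ((eventually_birkhoffExpMoment_div_lt hT hf hf2 h0
    ENNReal.ofReal_ne_top hs hM hfin (hK s ⟨hs, le_rfl⟩)).and ((eventually_gt_atTop 0).and
    (tendsto_natCast_atTop_atTop.eventually_ge_atTop (M / s)))).exists
  have hn' : (0 : ℝ) < n := by exact_mod_cast hn
  set t : ℝ := M / n with htdef
  have ht : 0 < t := by positivity
  have hts : t ≤ s := by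
    rw [htdef, div_le_iff₀ hn']
    rwa [div_le_iff₀ hs, mul_comm] at hns
  have hKt := hK t ⟨ht, hts⟩
  have hZ1 : birkhoffExpMoment μ T f t 1 ≠ ⊤ :=
    ne_top_of_le_ne_top (ENNReal.rpow_ne_top_of_nonneg (by positivity) hfin)
      (birkhoffExpMoment_le_rpow hT.measurable hf ht hts 1)
  have hZr : ∀ r, birkhoffExpMoment μ T f t r ≠ ⊤ := fun r =>
    ne_top_of_le_ne_top (ENNReal.pow_ne_top (ENNReal.mul_ne_top ENNReal.ofReal_ne_top hZ1))
      (birkhoffExpMoment_le_pow hKt r)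
  refine ⟨1 / n, by positivity, ENNReal.ofReal (Real.exp 1) *
    ∑ r ∈ Finset.range n, birkhoffExpMoment μ T f t r,
    ENNReal.mul_ne_top ENNReal.ofReal_ne_top (ENNReal.sum_ne_top.2 fun r _ => hZr r), ?_⟩
  intro N
  obtain ⟨k, r, hr, hN⟩ : ∃ k r, r < n ∧ N = k * n + r :=
    ⟨N / n, N % n, Nat.mod_lt _ hn, by rw [mul_comm]; exact (Nat.div_add_mod N n).symm⟩
  have hNr : (N : ℝ) = k * n + r := by exact_mod_cast hN
  have hmark : ENNReal.ofReal (Real.exp (t * (N * ε))) * μ {x | N * ε ≤ birkhoffSum T f N x}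
      ≤ birkhoffExpMoment μ T f t N := by
    refine le_trans ?_ (mul_meas_ge_le_lintegral
      (((measurable_birkhoffSum hT.measurable hf N).const_mul t).exp).ennreal_ofReal
        (ENNReal.ofReal (Real.exp (t * (N * ε)))))
    refine mul_le_mul' le_rfl (measure_mono fun x hx => ?_)
    exact ENNReal.ofReal_le_ofReal (Real.exp_le_exp.2 (mul_le_mul_of_nonneg_left hx ht.le))
  have hNk : (k : ℝ) * (κ + 2) ≤ t * (N * ε) := by
    have : t * (k * n * ε) ≤ t * (N * ε) := by
      gcongr
      rw [hNr]
      have : (0 : ℝ) ≤ r := by positivity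
      linarith
    refine le_trans (le_of_eq ?_) this
    rw [htdef, ← hMε]
    field_simp
  have hNn : (N : ℝ) * (1 / n) ≤ k + 1 := by
    rw [mul_one_div, div_le_iff₀ hn', hNr]
    have : (r : ℝ) ≤ n := by exact_mod_cast hr.le
    linarith
  calc μ {x | N * ε ≤ birkhoffSum T f N x}
      = ENNReal.ofReal (Real.exp (-(t * (N * ε)))) * (ENNReal.ofReal (Real.exp (t * (N * ε))) *
          μ {x | N * ε ≤ birkhoffSum T f N x}) := by
        rw [← mul_assoc, ← ENNReal.ofReal_mul (Real.exp_pos _).le, ← Real.exp_add,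
          neg_add_cancel, Real.exp_zero, ENNReal.ofReal_one, one_mul]
    _ ≤ ENNReal.ofReal (Real.exp (-(k * (κ + 2)))) * ((ENNReal.ofReal (Real.exp κ) *
          ENNReal.ofReal (Real.exp 1)) ^ k * birkhoffExpMoment μ T f t r) := by
        refine mul_le_mul' (by gcongr) (hmark.trans ?_)
        rw [hN]
        refine (birkhoffExpMoment_mul_add_le hKt k n r).trans ?_
        gcongr
    _ = ENNReal.ofReal (Real.exp (-k)) * birkhoffExpMoment μ T f t r := by
        rw [← mul_assoc, ← ENNReal.ofReal_mul (Real.exp_pos _).le,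
          ← ENNReal.ofReal_pow (by positivity), ← ENNReal.ofReal_mul (Real.exp_pos _).le,
          ← Real.exp_add, ← Real.exp_nat_mul, ← Real.exp_add]
        ring_nf
    _ ≤ (ENNReal.ofReal (Real.exp 1) * ENNReal.ofReal (Real.exp (-(N * (1 / n))))) *
          ∑ r ∈ Finset.range n, birkhoffExpMoment μ T f t r := by
        refine mul_le_mul' ?_ (Finset.single_le_sum
          (f := fun r => birkhoffExpMoment μ T f t r) (fun _ _ => zero_le)
          (Finset.mem_range.2 hr))
        rw [← ENNReal.ofReal_mul (Real.exp_pos _).le, ← Real.exp_add]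
        gcongr
        linarith
    _ = _ := by ring

end LargeDeviations

section GaussMap

variable {x y : ℝ} {a : ℕ} {l l' : List ℕ}

theorem gaussSet_pos (hx : x ∈ gaussSet) : 0 < x :=
  lt_of_le_of_ne hx.1.1 fun h => hx.2.ne_zero h.symm

theorem gaussSet_lt_one (hx : x ∈ gaussSet) : x < 1 :=
  lt_of_le_of_ne hx.1.2 hx.2.ne_one

theorem measurableSet_gaussSet : MeasurableSet gaussSet := by
  have : MeasurableSet {x : ℝ | Irrational x} :=
    (Set.countable_range ((↑) : ℚ → ℝ)).measurableSet.compl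
  exact measurableSet_Icc.inter this

theorem measurable_gaussMap : Measurable gaussMap := measurable_fract.comp measurable_inv

theorem measurable_cfDigit1 : Measurable cfDigit1 := Nat.measurable_floor.comp measurable_inv

theorem gaussPsi_eq (x : ℝ) : gaussPsi x = 2 * Real.log x := by
  simp [gaussPsi]

theorem measurable_gaussPsi : Measurable gaussPsi := by
  have : gaussPsi = fun x => 2 * Real.log x := funext gaussPsi_eq
  rw [this]
  exact Real.measurable_log.const_mul 2

theorem cfDigit1_add_gaussMap (hx : x ∈ gaussSet) : gaussMap x + cfDigit1 x = x⁻¹ := by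
  have h0 : 0 ≤ x⁻¹ := (inv_pos.2 (gaussSet_pos hx)).le
  rw [gaussMap, cfDigit1, natCast_floor_eq_intCast_floor h0, Int.fract_add_floor]

theorem gaussMap_mem (hx : x ∈ gaussSet) : gaussMap x ∈ gaussSet := by
  refine ⟨⟨Int.fract_nonneg _, (Int.fract_lt_one _).le⟩, ?_⟩
  have := cfDigit1_add_gaussMap hx
  rw [← irrational_add_natCast_iff (n := cfDigit1 x), this]
  exact irrational_inv_iff.2 hx.2

theorem gaussMap_iterate_mem (hx : x ∈ gaussSet) (n : ℕ) : gaussMap^[n] x ∈ gaussSet := by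
  induction n with
  | zero => exact hx
  | succ n ih =>
    rw [Function.iterate_succ_apply']
    exact gaussMap_mem ih

theorem cfDigit1_pos (hx : x ∈ gaussSet) : 0 < cfDigit1 x :=
  Nat.floor_pos.2 ((one_le_inv₀ (gaussSet_pos hx)).2 hx.1.2)

theorem invBranch1_mem (ha : 0 < a) (hx : x ∈ gaussSet) : invBranch1 a x ∈ gaussSet := by
  have h0 := gaussSet_pos hx
  have ha' : (1 : ℝ) ≤ a := by exact_mod_cast ha
  refine ⟨⟨by unfold invBranch1; positivity, inv_le_one_of_one_le₀ (by linarith)⟩, ?_⟩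
  exact irrational_inv_iff.2 (irrational_add_natCast_iff.2 hx.2)

theorem gaussMap_invBranch1 (a : ℕ) (hx : x ∈ gaussSet) : gaussMap (invBranch1 a x) = x := by
  rw [gaussMap, invBranch1, inv_inv, Int.fract_add_natCast]
  exact Int.fract_eq_self.2 ⟨hx.1.1, gaussSet_lt_one hx⟩

theorem cfDigit1_invBranch1 (a : ℕ) (hx : x ∈ gaussSet) : cfDigit1 (invBranch1 a x) = a := by
  rw [cfDigit1, invBranch1, inv_inv, Nat.floor_add_natCast hx.1.1,
    Nat.floor_eq_zero.2 (gaussSet_lt_one hx), zero_add]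

theorem mem_cylinder_nil : x ∈ cylinder [] ↔ x ∈ gaussSet := by
  simp [_root_.cylinder]

theorem mem_cylinder_cons :
    x ∈ cylinder (a :: l) ↔ x ∈ gaussSet ∧ cfDigit1 x = a ∧ gaussMap x ∈ cylinder l := by
  constructor
  · rintro ⟨hx, h⟩
    exact ⟨hx, h ⟨0, by simp⟩, gaussMap_mem hx, fun i => h i.succ⟩
  · rintro ⟨hx, ha, -, h⟩
    refine ⟨hx, fun i => ?_⟩
    induction i using Fin.cases with
    | zero => exact ha
    | succ i => exact h i

theorem cylinder_subset_gaussSet (l : List ℕ) : cylinder l ⊆ gaussSet := fun _ h => h.1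

theorem measurableSet_cylinder (l : List ℕ) : MeasurableSet (cylinder l) := by
  induction l with
  | nil =>
    convert measurableSet_gaussSet using 1
    exact Set.ext fun x => mem_cylinder_nil
  | cons a l ih =>
    have : cylinder (a :: l) = gaussSet ∩ (cfDigit1 ⁻¹' {a} ∩ gaussMap ⁻¹' cylinder l) :=
      Set.ext fun x => mem_cylinder_cons
    rw [this]
    exact measurableSet_gaussSet.inter
      ((measurable_cfDigit1 (measurableSet_singleton a)).inter (measurable_gaussMap ih))

theorem mem_cylinder_append :
    x ∈ cylinder (l ++ l') ↔ x ∈ cylinder l ∧ gaussMap^[l.length] x ∈ cylinder l' := by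
  induction l generalizing x with
  | nil => simpa [mem_cylinder_nil] using fun h => cylinder_subset_gaussSet _ h
  | cons a l ih =>
    rw [List.cons_append, mem_cylinder_cons, mem_cylinder_cons, ih, List.length_cons,
      Function.iterate_succ_apply]
    tauto

theorem invBranch_mem_cylinder (hl : ∀ a ∈ l, 0 < a) (hx : x ∈ gaussSet) :
    invBranch l x ∈ cylinder l := by
  induction l with
  | nil => exact mem_cylinder_nil.2 hx
  | cons a l ih =>
    have h := ih fun b hb => hl b (List.mem_cons_of_mem _ hb)
    have hg := cylinder_subset_gaussSet _ h
    refine mem_cylinder_cons.2 ⟨invBranch1_mem (hl a List.mem_cons_self) hg,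
      cfDigit1_invBranch1 a hg, ?_⟩
    change gaussMap (invBranch1 a (invBranch l x)) ∈ _
    rwa [gaussMap_invBranch1 a hg]

theorem gaussMap_iterate_invBranch (hl : ∀ a ∈ l, 0 < a) (hx : x ∈ gaussSet) :
    gaussMap^[l.length] (invBranch l x) = x := by
  induction l with
  | nil => rfl
  | cons a l ih =>
    have hl' : ∀ b ∈ l, 0 < b := fun b hb => hl b (List.mem_cons_of_mem _ hb)
    change gaussMap^[l.length] (gaussMap (invBranch1 a (invBranch l x))) = x
    rw [gaussMap_invBranch1 a (cylinder_subset_gaussSet _ (invBranch_mem_cylinder hl' hx)), ih hl']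

theorem invBranch_append (l l' : List ℕ) (x : ℝ) :
    invBranch (l ++ l') x = invBranch l (invBranch l' x) :=
  List.foldr_append

/-- The word of the first `n` continued fraction digits. -/
noncomputable def cfWord : ℕ → ℝ → List ℕ
  | 0, _ => []
  | n + 1, x => cfDigit1 x :: cfWord n (gaussMap x)

@[simp]
theorem length_cfWord (n : ℕ) (x : ℝ) : (cfWord n x).length = n := by
  induction n generalizing x with
  | zero => rfl
  | succ n ih => simp [cfWord, ih]

theorem cfWord_pos (hx : x ∈ gaussSet) (n : ℕ) : ∀ a ∈ cfWord n x, 0 < a := by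
  induction n generalizing x with
  | zero => simp [cfWord]
  | succ n ih =>
    simpa [cfWord] using ⟨cfDigit1_pos hx, ih (gaussMap_mem hx)⟩

theorem mem_cylinder_iff : x ∈ cylinder l ↔ x ∈ gaussSet ∧ cfWord l.length x = l := by
  induction l generalizing x with
  | nil => simp [mem_cylinder_nil, cfWord]
  | cons a l ih =>
    rw [mem_cylinder_cons, ih, List.length_cons, cfWord, List.cons.injEq]
    have := @gaussMap_mem x
    tauto

theorem mem_cylinder_cfWord (hx : x ∈ gaussSet) (n : ℕ) : x ∈ cylinder (cfWord n x) := by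
  rw [mem_cylinder_iff, length_cfWord]
  exact ⟨hx, rfl⟩

theorem cfWord_succ (n : ℕ) (x : ℝ) :
    cfWord (n + 1) x = cfWord n x ++ [cfDigit1 (gaussMap^[n] x)] := by
  induction n generalizing x with
  | zero => rfl
  | succ n ih =>
    rw [cfWord, ih, cfWord, List.cons_append, Function.iterate_succ_apply]

theorem cylinder_cfWord_succ_subset (n : ℕ) (x : ℝ) :
    cylinder (cfWord (n + 1) x) ⊆ cylinder (cfWord n x) := by
  intro y hy
  rw [cfWord_succ, mem_cylinder_append] at hy
  exact hy.1

theorem abs_log_add_sub_log_add_le (ha : 0 < a) (hx : x ∈ gaussSet) (hy : y ∈ gaussSet) :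
    |Real.log (x + a) - Real.log (y + a)| ≤ 1 / 2 * |Real.log x - Real.log y| := by
  wlog hxy : y ≤ x generalizing x y
  · rw [abs_sub_comm, abs_sub_comm (Real.log x)]
    exact this hy hx (le_of_not_ge hxy)
  have hx0 := gaussSet_pos hx
  have hy0 := gaussSet_pos hy
  have ha' : (1 : ℝ) ≤ a := by exact_mod_cast ha
  have h1 : Real.log (y + a) ≤ Real.log (x + a) := by gcongr
  have h2 : Real.log y ≤ Real.log x := by gcongr
  rw [abs_of_nonneg (by linarith), abs_of_nonneg (by linarith)]
  have h3 : (x + a) ^ 2 * y ≤ (y + a) ^ 2 * x := by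
    have hxy1 : x * y ≤ (a : ℝ) ^ 2 := by nlinarith [hx.1.2, hy.1.2]
    nlinarith [mul_nonneg (sub_nonneg.2 hxy) (sub_nonneg.2 hxy1)]
  have h4 := Real.log_le_log (by positivity) h3
  rw [Real.log_mul (by positivity) hy0.ne', Real.log_mul (by positivity) hx0.ne',
    Real.log_pow, Real.log_pow] at h4
  push_cast at h4
  linarith

theorem abs_log_add_sub_log_add_le_one (ha : 0 < a) (hx : x ∈ gaussSet) (hy : y ∈ gaussSet) :
    |Real.log (x + a) - Real.log (y + a)| ≤ 1 := by
  have ha' : (1 : ℝ) ≤ a := by exact_mod_cast ha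
  have key : ∀ z ∈ gaussSet, Real.log a ≤ Real.log (z + a) ∧
      Real.log (z + a) ≤ Real.log a + 1 := by
    intro z hz
    have hz0 := gaussSet_pos hz
    refine ⟨Real.log_le_log (by linarith) (by linarith), ?_⟩
    rw [← Real.log_exp 1, ← Real.log_mul (by positivity) (Real.exp_pos 1).ne']
    have := Real.add_one_le_exp (1 : ℝ)
    refine Real.log_le_log (by positivity) ?_
    nlinarith [hz.1.2]
  have h1 := key x hx
  have h2 := key y hy
  rw [abs_le]
  constructor <;> linarith [h1.1, h1.2, h2.1, h2.2]

theorem log_eq_of_mem_cylinder_cons (hx : x ∈ cylinder (a :: l)) :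
    Real.log x = -Real.log (gaussMap x + a) := by
  obtain ⟨hg, ha, -⟩ := mem_cylinder_cons.1 hx
  rw [← ha, cfDigit1_add_gaussMap hg, Real.log_inv, neg_neg]

theorem abs_log_sub_log_le (hl : l ≠ []) (hx : x ∈ cylinder l) (hy : y ∈ cylinder l) :
    |Real.log x - Real.log y| ≤ 2 * (1 / 2) ^ l.length := by
  induction l generalizing x y with
  | nil => exact absurd rfl hl
  | cons a l ih =>
    obtain ⟨hxg, hxa, hx'⟩ := mem_cylinder_cons.1 hx
    obtain ⟨hyg, -, hy'⟩ := mem_cylinder_cons.1 hy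
    have ha : 0 < a := hxa ▸ cfDigit1_pos hxg
    rw [log_eq_of_mem_cylinder_cons hx, log_eq_of_mem_cylinder_cons hy, neg_sub_neg,
      abs_sub_comm, List.length_cons, pow_succ]
    rcases eq_or_ne l [] with rfl | hne
    · simpa using abs_log_add_sub_log_add_le_one ha (gaussMap_mem hxg) (gaussMap_mem hyg)
    · linarith [abs_log_add_sub_log_add_le ha (gaussMap_mem hxg) (gaussMap_mem hyg),
        ih hne hx' hy']

theorem abs_birkhoffSum_gaussPsi_sub_le (hx : x ∈ cylinder l) (hy : y ∈ cylinder l) :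
    |birkhoffSum gaussMap gaussPsi l.length x - birkhoffSum gaussMap gaussPsi l.length y|
      ≤ 4 := by
  suffices |birkhoffSum gaussMap gaussPsi l.length x - birkhoffSum gaussMap gaussPsi l.length y|
      ≤ 4 * (1 - (1 / 2) ^ l.length) by
    have : (0 : ℝ) ≤ (1 / 2) ^ l.length := by positivity
    linarith
  induction l generalizing x y with
  | nil => simp
  | cons a l ih =>
    have h1 := ih (mem_cylinder_cons.1 hx).2.2 (mem_cylinder_cons.1 hy).2.2
    have h2 := abs_log_sub_log_le (List.cons_ne_nil a l) hx hy
    rw [List.length_cons] at h2 ⊢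
    rw [birkhoffSum_succ', birkhoffSum_succ', gaussPsi_eq, gaussPsi_eq]
    rw [pow_succ] at h2 ⊢
    rw [abs_le] at *
    constructor <;> linarith [h1.1, h1.2, h2.1, h2.2]

theorem abs_sub_le_of_mem_cylinder (hl : l ≠ []) (hx : x ∈ cylinder l) (hy : y ∈ cylinder l) :
    |x - y| ≤ 2 * (1 / 2) ^ l.length := by
  refine le_trans ?_ (abs_log_sub_log_le hl hx hy)
  have hxg := cylinder_subset_gaussSet _ hx
  have hyg := cylinder_subset_gaussSet _ hy
  clear hx hy
  wlog hxy : y ≤ x generalizing x y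
  · rw [abs_sub_comm, abs_sub_comm (Real.log x)]
    exact this hyg hxg (le_of_not_ge hxy)
  have hx0 := gaussSet_pos hxg
  have hy0 := gaussSet_pos hyg
  rw [abs_of_nonneg (by linarith), abs_of_nonneg (by
    linarith [Real.log_le_log hy0 hxy])]
  have h := Real.one_sub_inv_le_log_of_pos (div_pos hx0 hy0)
  rw [Real.log_div hx0.ne' hy0.ne', inv_div] at h
  have h3 : x - y ≤ 1 - y / x := by
    rw [one_sub_div hx0.ne', le_div_iff₀ hx0]
    nlinarith [hxg.1.2]
  linarith

instance (n : ℕ) : Countable (Word n) :=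
  inferInstanceAs (Countable {l : List ℕ // l.length = n ∧ ∀ a ∈ l, 0 < a})

theorem pairwise_disjoint_cylinder (n : ℕ) :
    Pairwise (Function.onFun Disjoint fun l : Word n => cylinder l.1) := by
  intro l l' hne
  refine Set.disjoint_left.2 fun x hx hx' => hne (Subtype.ext ?_)
  rw [mem_cylinder_iff, l.2.1] at hx
  rw [mem_cylinder_iff, l'.2.1] at hx'
  rw [← hx.2, ← hx'.2]

theorem iUnion_cylinder (n : ℕ) : ⋃ l : Word n, cylinder l.1 = gaussSet := by
  refine Set.Subset.antisymm (Set.iUnion_subset fun l => cylinder_subset_gaussSet _) fun x hx => ?_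
  exact Set.mem_iUnion.2 ⟨⟨cfWord n x, length_cfWord n x, cfWord_pos hx n⟩,
    mem_cylinder_cfWord hx n⟩

end GaussMap

section GibbsMeasure

variable {μ : Measure ℝ} {K : ℝ≥0∞}

/-- Two-sided quasi-multiplicativity of `μ` on cylinders. -/
def QuasiBernoulli (μ : Measure ℝ) (K : ℝ≥0∞) : Prop :=
  ∀ l l' : List ℕ, l ≠ [] → (∀ a ∈ l, 0 < a) → l' ≠ [] → (∀ a ∈ l', 0 < a) →
    μ (cylinder (l ++ l')) ≤ K * (μ (cylinder l) * μ (cylinder l')) ∧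
      μ (cylinder l) * μ (cylinder l') ≤ K * μ (cylinder (l ++ l'))

/-- An inequality between finite measures carried by `gaussSet` can be tested on cylinders. -/
theorem measure_le_of_forall_cylinder {ν₁ ν₂ : Measure ℝ} [IsFiniteMeasure ν₂]
    (h0 : ν₁ gaussSetᶜ = 0)
    (h : ∀ l : List ℕ, l ≠ [] → (∀ a ∈ l, 0 < a) → ν₁ (cylinder l) ≤ ν₂ (cylinder l)) :
    ν₁ ≤ ν₂ := by
  have hopen : ∀ U : Set ℝ, IsOpen U → ν₁ U ≤ ν₂ U := by
    intro U hU
    set V : ℕ → Set ℝ := fun n =>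
      ⋃ l : {l : Word (n + 1) // cylinder l.1 ⊆ U}, cylinder l.1.1 with hV
    have hmemV : ∀ n x, x ∈ V n ↔ x ∈ gaussSet ∧ cylinder (cfWord (n + 1) x) ⊆ U := by
      intro n x
      simp only [hV, Set.mem_iUnion]
      constructor
      · rintro ⟨⟨l, hl⟩, hx⟩
        rw [mem_cylinder_iff, l.2.1] at hx
        exact ⟨hx.1, by rwa [hx.2]⟩
      · rintro ⟨hx, hl⟩
        exact ⟨⟨⟨cfWord (n + 1) x, length_cfWord _ x, cfWord_pos hx _⟩, hl⟩,
          mem_cylinder_cfWord hx _⟩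
    have hVU : ∀ n, V n ⊆ U := fun n => Set.iUnion_subset fun l => l.2
    have hmono : Monotone V := by
      refine monotone_nat_of_le_succ fun n x hx => ?_
      rw [hmemV] at hx ⊢
      exact ⟨hx.1, (cylinder_cfWord_succ_subset _ x).trans hx.2⟩
    have hUV : U ∩ gaussSet ⊆ ⋃ n, V n := by
      rintro x ⟨hxU, hx⟩
      obtain ⟨r, hr, hball⟩ := Metric.isOpen_iff.1 hU x hxU
      obtain ⟨n, hn⟩ := exists_pow_lt_of_lt_one hr (by norm_num : (1 / 2 : ℝ) < 1)
      refine Set.mem_iUnion.2 ⟨n, (hmemV n x).2 ⟨hx, fun y hy => hball ?_⟩⟩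
      rw [Metric.mem_ball, Real.dist_eq]
      refine lt_of_le_of_lt (abs_sub_le_of_mem_cylinder ?_ hy (mem_cylinder_cfWord hx _)) ?_
      · rw [← List.length_pos_iff, length_cfWord]
        exact Nat.succ_pos n
      · rw [length_cfWord, pow_succ]
        linarith
    have hVle : ∀ n, ν₁ (V n) ≤ ν₂ U := by
      intro n
      refine le_trans ?_ (measure_mono (hVU n))
      have hd : Pairwise (Function.onFun Disjoint
          fun l : {l : Word (n + 1) // cylinder l.1 ⊆ U} => cylinder l.1.1) :=
        fun l l' hne => pairwise_disjoint_cylinder (n + 1) fun h => hne (Subtype.ext h)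
      simp only [hV]
      rw [measure_iUnion hd fun l => measurableSet_cylinder _,
        measure_iUnion hd fun l => measurableSet_cylinder _]
      refine ENNReal.tsum_le_tsum fun l => h _ ?_ l.1.2.2
      rw [← List.length_pos_iff, l.1.2.1]
      exact Nat.succ_pos n
    calc ν₁ U ≤ ν₁ (U ∩ gaussSet) + ν₁ gaussSetᶜ :=
          (measure_mono fun x hx => (em (x ∈ gaussSet)).imp (fun h => ⟨hx, h⟩) id).trans
            (measure_union_le _ _)
      _ = ν₁ (U ∩ gaussSet) := by rw [h0, add_zero]
      _ ≤ ν₁ (⋃ n, V n) := measure_mono hUV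
      _ = ⨆ n, ν₁ (V n) := hmono.measure_iUnion
      _ ≤ ν₂ U := iSup_le hVle
  intro s
  rw [s.measure_eq_iInf_isOpen ν₂]
  exact le_iInf₂ fun U hsU => le_iInf fun hU => (measure_mono hsU).trans (hopen U hU)

theorem IsGibbs.exists_quasiBernoulli [IsFiniteMeasure μ] {φ : ℝ → ℝ} (h : IsGibbs φ μ)
    (hne : gaussSet.Nonempty) :
    ∃ κ : ℝ, 0 ≤ κ ∧ QuasiBernoulli μ (ENNReal.ofReal (Real.exp κ)) := by
  obtain ⟨C, hC, hG⟩ := h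
  obtain ⟨p, hp⟩ := hne
  have hC0 : 0 < C := by linarith
  refine ⟨Real.log (C ^ 3), Real.log_nonneg (one_le_pow₀ hC), ?_⟩
  rw [Real.exp_log (by positivity)]
  intro l l' hl hlp hl' hlp'
  have hll : ∀ a ∈ l ++ l', 0 < a := fun a ha => (List.mem_append.1 ha).elim (hlp a) (hlp' a)
  have hq : invBranch l' p ∈ gaussSet :=
    cylinder_subset_gaussSet _ (invBranch_mem_cylinder hlp' hp)
  obtain ⟨h1, h1'⟩ := hG l hl hlp _ hq
  obtain ⟨h2, h2'⟩ := hG l' hl' hlp' p hp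
  obtain ⟨h3, h3'⟩ := hG (l ++ l') (by simp [hl]) hll p hp
  have hsum : birkhoff φ (l ++ l').length (invBranch (l ++ l') p)
      = birkhoff φ l.length (invBranch l (invBranch l' p))
        + birkhoff φ l'.length (invBranch l' p) := by
    have := birkhoffSum_add gaussMap φ l.length l'.length (invBranch l (invBranch l' p))
    rw [gaussMap_iterate_invBranch hlp hq] at this
    rw [invBranch_append, List.length_append]
    exact this
  rw [hsum, Real.exp_add] at h3 h3'
  set A := Real.exp (birkhoff φ l.length (invBranch l (invBranch l' p)))
  set B := Real.exp (birkhoff φ l'.length (invBranch l' p))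
  have hA : 0 < A := Real.exp_pos _
  have hB : 0 < B := Real.exp_pos _
  rw [inv_mul_le_iff₀ hC0] at h1 h2 h3
  have hm : ∀ s, μ s = ENNReal.ofReal (μ s).toReal := fun s =>
    (ENNReal.ofReal_toReal (measure_ne_top μ s)).symm
  rw [hm (cylinder (l ++ l')), hm (cylinder l), hm (cylinder l'),
    ← ENNReal.ofReal_mul ENNReal.toReal_nonneg, ← ENNReal.ofReal_mul (by positivity),
    ← ENNReal.ofReal_mul (by positivity)]
  constructor
  · refine ENNReal.ofReal_le_ofReal (h3'.trans ?_)
    calc C * (A * B) ≤ C * ((C * (μ (cylinder l)).toReal) * (C * (μ (cylinder l')).toReal)) := by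
          gcongr
      _ = _ := by ring
  · refine ENNReal.ofReal_le_ofReal ?_
    calc (μ (cylinder l)).toReal * (μ (cylinder l')).toReal ≤ (C * A) * (C * B) := by gcongr
      _ = C ^ 2 * (A * B) := by ring
      _ ≤ C ^ 2 * (C * (μ (cylinder (l ++ l'))).toReal) := by gcongr
      _ = _ := by ring

theorem map_restrict_cylinder_apply (l : List ℕ) {s : Set ℝ} (hs : MeasurableSet s) :
    (μ.restrict (cylinder l)).map gaussMap^[l.length] s
      = μ (cylinder l ∩ gaussMap^[l.length] ⁻¹' s) := by
  have hT := measurable_gaussMap.iterate l.length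
  rw [Measure.map_apply hT hs, Measure.restrict_apply (hT hs), Set.inter_comm]

theorem map_restrict_cylinder_apply_cylinder (l l' : List ℕ) :
    (μ.restrict (cylinder l)).map gaussMap^[l.length] (cylinder l') = μ (cylinder (l ++ l')) := by
  rw [map_restrict_cylinder_apply l (measurableSet_cylinder l')]
  congr 1
  exact Set.ext fun x => mem_cylinder_append.symm

theorem QuasiBernoulli.map_restrict_le [IsFiniteMeasure μ] (h : QuasiBernoulli μ K)
    (hK : K ≠ ⊤) {l : List ℕ} (hl : l ≠ []) (hlp : ∀ a ∈ l, 0 < a) :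
    (μ.restrict (cylinder l)).map gaussMap^[l.length] ≤ (K * μ (cylinder l)) • μ := by
  have : IsFiniteMeasure ((K * μ (cylinder l)) • μ) :=
    μ.smul_finite (ENNReal.mul_ne_top hK (measure_ne_top μ _))
  refine measure_le_of_forall_cylinder ?_ fun l' hl' hlp' => ?_
  · rw [map_restrict_cylinder_apply l measurableSet_gaussSet.compl]
    convert measure_empty (μ := μ)
    exact Set.eq_empty_iff_forall_notMem.2 fun x hx =>
      hx.2 (gaussMap_iterate_mem (cylinder_subset_gaussSet _ hx.1) _)
  · rw [map_restrict_cylinder_apply_cylinder, Measure.smul_apply, smul_eq_mul, mul_assoc]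
    exact (h l l' hl hlp hl' hlp').1

theorem QuasiBernoulli.smul_le_map_restrict [IsFiniteMeasure μ] (h : QuasiBernoulli μ K)
    (hK : K ≠ ⊤) (hμ : μ gaussSetᶜ = 0) {l : List ℕ} (hl : l ≠ []) (hlp : ∀ a ∈ l, 0 < a) :
    μ (cylinder l) • μ ≤ K • (μ.restrict (cylinder l)).map gaussMap^[l.length] := by
  have : IsFiniteMeasure (K • (μ.restrict (cylinder l)).map gaussMap^[l.length]) :=
    Measure.smul_finite _ hK
  refine measure_le_of_forall_cylinder ?_ fun l' hl' hlp' => ?_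
  · rw [Measure.smul_apply, hμ, smul_zero]
  · rw [Measure.smul_apply, Measure.smul_apply, map_restrict_cylinder_apply_cylinder, smul_eq_mul,
      smul_eq_mul]
    exact (h l l' hl hlp hl' hlp').2

theorem QuasiBernoulli.ergodic [IsFiniteMeasure μ] (h : QuasiBernoulli μ K)
    (hK : K ≠ ⊤) (hμ : μ gaussSetᶜ = 0) (hinv : MeasurePreserving gaussMap μ μ) :
    Ergodic gaussMap μ := by
  refine ⟨hinv, ⟨fun s hs hTs => ?_⟩⟩
  have hit : ∀ n, gaussMap^[n] ⁻¹' s = s := by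
    intro n
    induction n with
    | zero => rfl
    | succ n ih => rw [Function.iterate_succ, Set.preimage_comp, ih, hTs]
  have hle : μ s • μ ≤ K • μ.restrict s := by
    have : IsFiniteMeasure (K • μ.restrict s) := Measure.smul_finite _ hK
    refine measure_le_of_forall_cylinder ?_ fun l hl hlp => ?_
    · rw [Measure.smul_apply, hμ, smul_zero]
    · have := h.smul_le_map_restrict hK hμ hl hlp s
      rw [Measure.smul_apply, Measure.smul_apply, map_restrict_cylinder_apply l hs, hit,
        smul_eq_mul, smul_eq_mul] at this
      rwa [Measure.smul_apply, Measure.smul_apply, Measure.restrict_apply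
        (measurableSet_cylinder l), smul_eq_mul, smul_eq_mul, mul_comm]
  have h0 := hle sᶜ
  rw [Measure.smul_apply, Measure.smul_apply, Measure.restrict_apply hs.compl,
    Set.compl_inter_self, measure_empty, smul_zero, smul_eq_mul, nonpos_iff_eq_zero,
    mul_eq_zero] at h0
  rw [eventuallyConst_set']
  rcases h0 with h0 | h0
  · exact Or.inl (ae_eq_empty.2 h0)
  · exact Or.inr (ae_eq_univ.2 h0)

theorem lintegral_eq_tsum_cylinder (hμ : μ gaussSetᶜ = 0) (n : ℕ) (F : ℝ → ℝ≥0∞) :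
    ∫⁻ x, F x ∂μ = ∑' l : Word n, ∫⁻ x in cylinder l.1, F x ∂μ := by
  rw [← lintegral_iUnion (fun l => measurableSet_cylinder _) (pairwise_disjoint_cylinder n),
    iUnion_cylinder, setLIntegral_congr (ae_eq_univ.2 hμ), Measure.restrict_univ]

theorem QuasiBernoulli.birkhoffExpMoment_add_le [IsProbabilityMeasure μ]
    (h : QuasiBernoulli μ K) (hK : K ≠ ⊤) (hK1 : 1 ≤ K) (hμ : μ gaussSetᶜ = 0)
    {f : ℝ → ℝ} (hf : Measurable f) {D : ℝ}
    (hD : ∀ l : List ℕ, ∀ x ∈ cylinder l, ∀ y ∈ cylinder l,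
      |birkhoffSum gaussMap f l.length x - birkhoffSum gaussMap f l.length y| ≤ D)
    (hD0 : 0 ≤ D) {t : ℝ} (ht : 0 ≤ t) (n m : ℕ) :
    birkhoffExpMoment μ gaussMap f t (n + m) ≤ K * ENNReal.ofReal (Real.exp (2 * (t * D))) *
      birkhoffExpMoment μ gaussMap f t n * birkhoffExpMoment μ gaussMap f t m := by
  rcases Nat.eq_zero_or_pos n with rfl | hn
  · rw [birkhoffExpMoment_zero_right, mul_one, zero_add]
    refine le_mul_of_one_le_left zero_le (one_le_mul hK1 ?_)
    rw [ENNReal.one_le_ofReal]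
    exact Real.one_le_exp (by positivity)
  set F : ℕ → ℝ → ℝ≥0∞ :=
    fun k x => ENNReal.ofReal (Real.exp (t * birkhoffSum gaussMap f k x)) with hF
  have hFm : ∀ k, Measurable (F k) := fun k =>
    (((measurable_birkhoffSum measurable_gaussMap hf k).const_mul t).exp).ennreal_ofReal
  have hFadd : ∀ x, F (n + m) x = F n x * F m (gaussMap^[n] x) := by
    intro x
    simp only [hF]
    rw [birkhoffSum_add, mul_add, Real.exp_add, ENNReal.ofReal_mul (Real.exp_pos _).le]
  have hcomp : ∀ l : Word n, ∀ x ∈ cylinder l.1, ∀ y ∈ cylinder l.1,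
      F n x ≤ ENNReal.ofReal (Real.exp (t * D)) * F n y := by
    intro l x hx y hy
    simp only [hF]
    rw [← ENNReal.ofReal_mul (Real.exp_pos _).le, ← Real.exp_add, ← mul_add]
    refine ENNReal.ofReal_le_ofReal (Real.exp_le_exp.2 (mul_le_mul_of_nonneg_left ?_ ht))
    have := hD l.1 x hx y hy
    rw [l.2.1] at this
    linarith [(abs_le.1 this).2]
  have hmain : ∀ l : Word n, ∫⁻ x in cylinder l.1, F (n + m) x ∂μ ≤
      K * ENNReal.ofReal (Real.exp (2 * (t * D))) * (∫⁻ x in cylinder l.1, F n x ∂μ) *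
        ∫⁻ x, F m x ∂μ := by
    intro l
    rcases (cylinder l.1).eq_empty_or_nonempty with he | ⟨p, hp⟩
    · simp [he]
    have hl : l.1 ≠ [] := by rwa [← List.length_pos_iff, l.2.1]
    set E := ENNReal.ofReal (Real.exp (t * D)) with hE
    have hEE : ENNReal.ofReal (Real.exp (2 * (t * D))) = E * E := by
      rw [hE, ← ENNReal.ofReal_mul (Real.exp_pos _).le, ← Real.exp_add, two_mul]
    have hmap := h.map_restrict_le hK hl l.2.2
    rw [l.2.1] at hmap
    have h1 : ∫⁻ x in cylinder l.1, F m (gaussMap^[n] x) ∂μ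
        ≤ K * μ (cylinder l.1) * ∫⁻ x, F m x ∂μ := by
      rw [← lintegral_map (hFm m) (measurable_gaussMap.iterate n), ← smul_eq_mul,
        ← lintegral_smul_measure]
      exact lintegral_mono' hmap le_rfl
    have h2 : F n p * μ (cylinder l.1) ≤ E * ∫⁻ x in cylinder l.1, F n x ∂μ := by
      rw [← setLIntegral_const, ← lintegral_const_mul _ (hFm n)]
      exact setLIntegral_mono ((hFm n).const_mul _) fun x hx => hcomp l p hp x hx
    calc ∫⁻ x in cylinder l.1, F (n + m) x ∂μ
        ≤ ∫⁻ x in cylinder l.1, E * F n p * F m (gaussMap^[n] x) ∂μ := by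
          refine setLIntegral_mono
            (((hFm m).comp (measurable_gaussMap.iterate n)).const_mul _) fun x hx => ?_
          rw [hFadd]
          gcongr
          exact hcomp l x hx p hp
      _ = E * F n p * ∫⁻ x in cylinder l.1, F m (gaussMap^[n] x) ∂μ :=
          lintegral_const_mul _ ((hFm m).comp (measurable_gaussMap.iterate n))
      _ ≤ E * F n p * (K * μ (cylinder l.1) * ∫⁻ x, F m x ∂μ) := by gcongr
      _ = E * K * (F n p * μ (cylinder l.1)) * ∫⁻ x, F m x ∂μ := by ring
      _ ≤ E * K * (E * ∫⁻ x in cylinder l.1, F n x ∂μ) * ∫⁻ x, F m x ∂μ := by gcongr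
      _ = _ := by rw [hEE]; ring
  change ∫⁻ x, F (n + m) x ∂μ ≤ K * ENNReal.ofReal (Real.exp (2 * (t * D))) *
    (∫⁻ x, F n x ∂μ) * ∫⁻ x, F m x ∂μ
  rw [lintegral_eq_tsum_cylinder hμ n (F (n + m)), lintegral_eq_tsum_cylinder hμ n (F n),
    ← ENNReal.tsum_mul_left, ← ENNReal.tsum_mul_right]
  exact ENNReal.tsum_le_tsum hmain

end GibbsMeasure

section PeriodicPoint

/-- The positive fixed point of the inverse branch `T_a`. -/
theorem exists_mem_gaussSet_invBranch1_eq {a : ℕ} (ha : 0 < a) :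
    ∃ z ∈ gaussSet, invBranch1 a z = z := by
  have ha' : (1 : ℝ) ≤ a := by exact_mod_cast ha
  set r := √((a : ℝ) ^ 2 + 4) with hr
  have hr2 : r ^ 2 = (a : ℝ) ^ 2 + 4 := Real.sq_sqrt (by positivity)
  have hr0 : 0 ≤ r := Real.sqrt_nonneg _
  have hirr : Irrational r := by
    have hcast : ((a ^ 2 + 4 : ℕ) : ℝ) = (a : ℝ) ^ 2 + 4 := by push_cast; ring
    rw [hr, ← hcast, irrational_sqrt_natCast_iff]
    rintro ⟨b, hb⟩
    have h1 : a < b := by nlinarith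
    have h2 : b < a + 3 := by nlinarith
    obtain rfl | rfl : b = a + 1 ∨ b = a + 2 := by lia
    · ring_nf at hb
      lia
    · nlinarith
  refine ⟨(r - a) / 2, ⟨⟨?_, ?_⟩, ?_⟩, ?_⟩
  · nlinarith
  · nlinarith
  · exact_mod_cast (hirr.sub_natCast a).div_natCast (m := 2) two_ne_zero
  · rw [invBranch1]
    refine inv_eq_of_mul_eq_one_right ?_
    linear_combination hr2 / 4

theorem abs_invBranch_replicate_sub_le {a : ℕ} {u z : ℝ} (ha : 0 < a) (hu : 0 ≤ u)
    (hz : z ∈ gaussSet) (hfix : invBranch1 a z = z) (k : ℕ) :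
    0 ≤ invBranch (List.replicate k a) u ∧
      |invBranch (List.replicate k a) u - z| ≤ z ^ k * |u - z| := by
  have ha' : (1 : ℝ) ≤ a := by exact_mod_cast ha
  have hz0 := gaussSet_pos hz
  induction k with
  | zero => simpa [invBranch] using hu
  | succ k ih =>
    obtain ⟨h0, hk⟩ := ih
    set v := invBranch (List.replicate k a) u
    have hv : invBranch (List.replicate (k + 1) a) u = (v + a)⁻¹ := rfl
    have hva : 0 < v + a := by linarith
    have hza : 0 < z + a := by linarith
    rw [hv]
    refine ⟨by positivity, ?_⟩
    have hfix' : z = (z + a)⁻¹ := hfix.symm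
    have heq : (v + a)⁻¹ - z = (v + a)⁻¹ * (z * (z - v)) := by
      have h1 : z * (z + a) = 1 := by
        nth_rewrite 1 [hfix']
        exact inv_mul_cancel₀ hza.ne'
      field_simp
      linarith
    rw [heq, abs_mul, abs_mul, abs_of_pos (inv_pos.2 hva), abs_of_pos hz0, abs_sub_comm z v,
      pow_succ]
    have hinv : (v + a)⁻¹ ≤ 1 := inv_le_one_of_one_le₀ (by linarith)
    calc (v + a)⁻¹ * (z * |v - z|) ≤ 1 * (z * (z ^ k * |u - z|)) := by gcongr
      _ = z ^ k * z * |u - z| := by ring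

theorem periodicPoint_singleton {a : ℕ} {z : ℝ} (ha : 0 < a) (hz : z ∈ gaussSet)
    (hfix : invBranch1 a z = z) : periodicPoint [a] = z := by
  refine Tendsto.limUnder_eq ?_
  have hflat : ∀ k : ℕ, List.flatten (List.replicate k [a]) = List.replicate k a := by
    intro k
    simp
  simp only [hflat]
  rw [tendsto_iff_norm_sub_tendsto_zero]
  refine squeeze_zero (fun k => norm_nonneg _)
    (fun k => (abs_invBranch_replicate_sub_le ha (by norm_num) hz hfix k).2) ?_
  simpa using (tendsto_pow_atTop_nhds_zero_of_lt_one hz.1.1 (gaussSet_lt_one hz)).mul_const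
    |(1 / 2 : ℝ) - z|

theorem periodicPoint_singleton_mem {a : ℕ} (ha : 0 < a) :
    periodicPoint [a] ∈ gaussSet ∧ invBranch [a] (periodicPoint [a]) = periodicPoint [a] := by
  obtain ⟨z, hz, hfix⟩ := exists_mem_gaussSet_invBranch1_eq ha
  rw [periodicPoint_singleton ha hz hfix]
  exact ⟨hz, hfix⟩

end PeriodicPoint

section Lyapunov

variable {μ : Measure ℝ} {φ : ℝ → ℝ}

theorem IsGibbs.lintegral_exp_abs_gaussPsi_ne_top [IsFiniteMeasure μ] (h : IsGibbs φ μ)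
    (hμ : μ gaussSetᶜ = 0) {s : ℝ} (hs : 0 ≤ s)
    (hsum : partSum (fun x => -s * gaussPsi x + φ x) 1 ≠ ⊤) :
    ∫⁻ x, ENNReal.ofReal (Real.exp (s * |gaussPsi x|)) ∂μ ≠ ⊤ := by
  obtain ⟨C, hC, hG⟩ := h
  have key : ∀ l : Word 1, ∫⁻ x in cylinder l.1, ENNReal.ofReal (Real.exp (s * |gaussPsi x|)) ∂μ ≤
      ENNReal.ofReal (C * Real.exp (4 * s)) * ENNReal.ofReal (Real.exp
        (birkhoff (fun x => -s * gaussPsi x + φ x) 1 (periodicPoint l.1))) := by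
    rintro ⟨l, hl, hpos⟩
    obtain ⟨a, rfl⟩ := List.length_eq_one_iff.1 hl
    obtain ⟨hp, hfix⟩ := periodicPoint_singleton_mem (hpos a (by simp))
    dsimp only
    set p := periodicPoint [a]
    have hpc : p ∈ cylinder [a] := hfix ▸ invBranch_mem_cylinder hpos hp
    have hb : ∀ x ∈ cylinder [a], s * |gaussPsi x| ≤ s * (4 - gaussPsi p) := by
      intro x hx
      have hxg := cylinder_subset_gaussSet _ hx
      have h4 := abs_birkhoffSum_gaussPsi_sub_le hx hpc
      simp only [List.length_singleton, birkhoffSum_one] at h4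
      have hneg : gaussPsi x ≤ 0 := by
        rw [gaussPsi_eq]
        linarith [Real.log_nonpos hxg.1.1 hxg.1.2]
      rw [abs_of_nonpos hneg]
      gcongr
      linarith [(abs_le.1 h4).1]
    have hcyl : μ (cylinder [a]) ≤ ENNReal.ofReal (C * Real.exp (φ p)) := by
      have := (hG [a] (by simp) hpos p hp).2
      rw [hfix] at this
      rw [← ENNReal.ofReal_toReal (measure_ne_top μ (cylinder [a]))]
      refine ENNReal.ofReal_le_ofReal (this.trans_eq ?_)
      simp [birkhoff]
    calc ∫⁻ x in cylinder [a], ENNReal.ofReal (Real.exp (s * |gaussPsi x|)) ∂μ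
        ≤ ∫⁻ _ in cylinder [a], ENNReal.ofReal (Real.exp (s * (4 - gaussPsi p))) ∂μ :=
          setLIntegral_mono' (measurableSet_cylinder _) fun x hx =>
            ENNReal.ofReal_le_ofReal (Real.exp_le_exp.2 (hb x hx))
      _ = ENNReal.ofReal (Real.exp (s * (4 - gaussPsi p))) * μ (cylinder [a]) :=
          setLIntegral_const _ _
      _ ≤ ENNReal.ofReal (Real.exp (s * (4 - gaussPsi p))) *
            ENNReal.ofReal (C * Real.exp (φ p)) := by gcongr
      _ = _ := by
          rw [← ENNReal.ofReal_mul (Real.exp_pos _).le, ← ENNReal.ofReal_mul (by positivity)]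
          congr 1
          simp only [birkhoff, Finset.range_one, Finset.sum_singleton, Function.iterate_zero, id]
          rw [mul_left_comm, mul_assoc, ← Real.exp_add, ← Real.exp_add]
          congr 2
          ring
  rw [lintegral_eq_tsum_cylinder hμ 1]
  refine ((ENNReal.tsum_le_tsum key).trans_lt ?_).ne
  rw [ENNReal.tsum_mul_left]
  exact ENNReal.mul_lt_top ENNReal.ofReal_lt_top hsum.lt_top

theorem memLp_two_of_lintegral_exp_ne_top {Ω : Type*} [MeasurableSpace Ω] {ν : Measure Ω}
    {f : Ω → ℝ} (hf : Measurable f) {s : ℝ} (hs : 0 < s)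
    (h : ∫⁻ x, ENNReal.ofReal (Real.exp (s * |f x|)) ∂ν ≠ ⊤) : MemLp f 2 ν := by
  have hm : Measurable fun x => Real.exp (s * |f x|) :=
    Real.measurable_exp.comp (measurable_const.mul hf.abs)
  have hint : Integrable (fun x => Real.exp (s * |f x|)) ν :=
    (lintegral_ofReal_ne_top_iff_integrable hm.aestronglyMeasurable
      (ae_of_all _ fun x => (Real.exp_pos _).le)).1 h
  rw [memLp_two_iff_integrable_sq hf.aestronglyMeasurable]
  refine (hint.const_mul (2 / s ^ 2)).mono' (hf.pow_const 2).aestronglyMeasurable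
    (ae_of_all _ fun x => ?_)
  have hq := Real.quadratic_le_exp_of_nonneg (x := s * |f x|) (by positivity)
  have hq' : (s * |f x|) ^ 2 ≤ 2 * Real.exp (s * |f x|) := by
    nlinarith [mul_nonneg hs.le (abs_nonneg (f x))]
  rw [Real.norm_eq_abs, abs_of_nonneg (sq_nonneg _), div_mul_eq_mul_div,
    le_div_iff₀ (by positivity), mul_comm, ← sq_abs (f x), ← mul_pow]
  exact hq'

/-- Upper large deviations for a centred observable which is bounded by `|ψ|` up to a constant and
whose Birkhoff sums have bounded distortion on cylinders. -/
theorem QuasiBernoulli.measure_birkhoffSum_ge_le [IsProbabilityMeasure μ] {κ : ℝ} (hκ : 0 ≤ κ)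
    (h : QuasiBernoulli μ (ENNReal.ofReal (Real.exp κ))) (hμ : μ gaussSetᶜ = 0)
    (hinv : MeasurePreserving gaussMap μ μ) {f : ℝ → ℝ} (hf : Measurable f) (hf2 : MemLp f 2 μ)
    (h0 : ∫ x, f x ∂μ = 0) {D : ℝ} (hD0 : 0 ≤ D)
    (hD : ∀ l : List ℕ, ∀ x ∈ cylinder l, ∀ y ∈ cylinder l,
      |birkhoffSum gaussMap f l.length x - birkhoffSum gaussMap f l.length y| ≤ D)
    {s : ℝ} (hs : 0 < s) (hfin : ∫⁻ x, ENNReal.ofReal (Real.exp (s * f x)) ∂μ ≠ ⊤)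
    {ε : ℝ} (hε : 0 < ε) :
    ∃ δ > 0, ∃ B : ℝ≥0∞, B ≠ ⊤ ∧ ∀ N : ℕ,
      μ {x | N * ε ≤ birkhoffSum gaussMap f N x} ≤ B * ENNReal.ofReal (Real.exp (-(N * δ))) := by
  have hsD : 0 ≤ 2 * (s * D) := by positivity
  refine (h.ergodic ENNReal.ofReal_ne_top hμ hinv).measure_birkhoffSum_ge_le hf hf2 h0
    (κ := κ + 2 * (s * D)) (add_nonneg hκ hsD) hs ?_ (fun t ht n m => ?_) hε
  · simpa [birkhoffExpMoment] using hfin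
  · refine (h.birkhoffExpMoment_add_le ENNReal.ofReal_ne_top ?_ hμ hf hD hD0 ht.1.le n m).trans ?_
    · exact ENNReal.one_le_ofReal.2 (Real.one_le_exp hκ)
    · rw [← ENNReal.ofReal_mul (Real.exp_pos _).le, ← Real.exp_add]
      gcongr
      exact ht.2

theorem exists_forall_ge_le_exp {u : ℕ → ℝ≥0∞} {B : ℝ≥0∞} (hB : B ≠ ⊤) {δ : ℝ} (hδ : 0 < δ)
    (hu : ∀ n : ℕ, u n ≤ B * ENNReal.ofReal (Real.exp (-(n * δ)))) :
    ∃ n₁ : ℕ, ∀ n : ℕ, n₁ ≤ n → (u n).toReal ≤ Real.exp (-(n * (δ / 2))) := by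
  have hlim : Tendsto (fun n : ℕ => (n : ℝ) * (δ / 2)) atTop atTop :=
    tendsto_natCast_atTop_atTop.atTop_mul_const (half_pos hδ)
  obtain ⟨n₁, h₁⟩ := eventually_atTop.1
    ((Real.tendsto_exp_atTop.comp hlim).eventually_ge_atTop B.toReal)
  refine ⟨n₁, fun n hn => ENNReal.toReal_le_of_le_ofReal (Real.exp_pos _).le ((hu n).trans ?_)⟩
  rw [← ENNReal.ofReal_toReal hB, ← ENNReal.ofReal_mul ENNReal.toReal_nonneg]
  refine ENNReal.ofReal_le_ofReal ?_
  calc B.toReal * Real.exp (-(n * δ)) ≤ Real.exp (n * (δ / 2)) * Real.exp (-(n * δ)) := by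
        gcongr
        exact h₁ n hn
    _ = Real.exp (-(n * (δ / 2))) := by
        rw [← Real.exp_add]
        ring_nf

end Lyapunov

/-- Large deviations for the Lyapunov observable `ψ = -log|T'|`:
for every `ε > 0` there are `δ > 0` and `n₁` with
`μ_φ({x : |S_nψ(x) + nλ| ≥ nε}) ≤ e^{-nδ}` for all `n ≥ n₁`, where `λ = -∫ψ dμ_φ`. -/
theorem gibbs_large_deviation_lyapunov
    (φ : ℝ → ℝ) (μ : MeasureTheory.Measure ℝ) [MeasureTheory.IsProbabilityMeasure μ]
    (hμX : μ gaussSet = 1) (hinv : GaussInvariant μ)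
    (hφH : LocHolder φ) (hφ0 : ∀ x ∈ gaussSet, φ x ≤ 0) (hP : HasPressure φ 0)
    (hGibbs : IsGibbs φ μ)
    (hfin : ∃ t₀ > (0:ℝ), ∀ t : ℝ, |t| < t₀ →
      PressureFinite fun x => t * gaussPsi x + φ x) :
    ∀ ε > (0:ℝ), ∃ δ > (0:ℝ), ∃ n₁ : ℕ, ∀ n : ℕ, n₁ ≤ n →
      (μ {x | (n : ℝ) * ε ≤
          |birkhoff gaussPsi n x + (n : ℝ) * (-∫ y, gaussPsi y ∂μ)|}).toReal
        ≤ Real.exp (-((n : ℝ) * δ)) := by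
  intro ε hε
  obtain ⟨t₀, ht₀, hfin⟩ := hfin
  obtain ⟨p, hp, -⟩ := hfin (-(t₀ / 2)) (by rw [abs_neg, abs_of_pos (half_pos ht₀)]; linarith)
  have hs : 0 < t₀ / 2 := half_pos ht₀
  set s := t₀ / 2
  have hμ : μ gaussSetᶜ = 0 := (prob_compl_eq_zero_iff measurableSet_gaussSet).2 hμX
  have hne : gaussSet.Nonempty := nonempty_of_measure_ne_zero (μ := μ) (by simp [hμX])
  have hpres : MeasurePreserving gaussMap μ μ :=
    ⟨measurable_gaussMap, Measure.ext fun t ht => by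
      rw [Measure.map_apply measurable_gaussMap ht, hinv t ht]⟩
  obtain ⟨κ, hκ, hQ⟩ := hGibbs.exists_quasiBernoulli hne
  have hexp := hGibbs.lintegral_exp_abs_gaussPsi_ne_top hμ hs.le (hp 1 one_pos)
  have hψ2 : MemLp gaussPsi 2 μ := memLp_two_of_lintegral_exp_ne_top measurable_gaussPsi hs hexp
  have hψ1 : Integrable gaussPsi μ := hψ2.integrable (by norm_num)
  set m := ∫ y, gaussPsi y ∂μ with hm
  have hfin' : ∀ c : ℝ, |c| = 1 →
      ∫⁻ x, ENNReal.ofReal (Real.exp (s * (c * (gaussPsi x - m)))) ∂μ ≠ ⊤ := by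
    intro c hc
    have hb : ∀ x, ENNReal.ofReal (Real.exp (s * (c * (gaussPsi x - m)))) ≤
        ENNReal.ofReal (Real.exp (s * |m|)) * ENNReal.ofReal (Real.exp (s * |gaussPsi x|)) := by
      intro x
      rw [← ENNReal.ofReal_mul (Real.exp_pos _).le, ← Real.exp_add, ← mul_add]
      refine ENNReal.ofReal_le_ofReal (Real.exp_le_exp.2 (mul_le_mul_of_nonneg_left ?_ hs.le))
      calc c * (gaussPsi x - m) ≤ |c| * |gaussPsi x - m| := (le_abs_self _).trans (abs_mul _ _).le
        _ ≤ |m| + |gaussPsi x| := by rw [hc, one_mul, add_comm]; exact abs_sub _ _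
    refine ((lintegral_mono hb).trans_lt ?_).ne
    rw [lintegral_const_mul' _ _ ENNReal.ofReal_ne_top]
    exact ENNReal.mul_lt_top ENNReal.ofReal_lt_top hexp.lt_top
  have hsum : ∀ (c : ℝ) (n : ℕ) (x : ℝ), birkhoffSum gaussMap (fun x => c * (gaussPsi x - m)) n x =
      c * (birkhoffSum gaussMap gaussPsi n x - n * m) := by
    intro c n x
    simp [birkhoffSum, ← Finset.mul_sum]
  have hLD : ∀ c : ℝ, |c| = 1 → ∃ δ > 0, ∃ B : ℝ≥0∞, B ≠ ⊤ ∧ ∀ N : ℕ,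
      μ {x | N * ε ≤ c * (birkhoffSum gaussMap gaussPsi N x - N * m)} ≤
        B * ENNReal.ofReal (Real.exp (-(N * δ))) := by
    intro c hc
    simp only [← hsum]
    refine hQ.measure_birkhoffSum_ge_le hκ hμ hpres
      ((measurable_gaussPsi.sub_const m).const_mul c) ((hψ2.sub (memLp_const m)).const_mul c) ?_
      (D := 4) (by norm_num) (fun l x hx y hy => ?_) hs (hfin' c hc) hε
    · rw [integral_const_mul, integral_sub hψ1 (integrable_const m)]
      simp [hm]
    · rw [hsum, hsum, ← mul_sub, abs_mul, hc, one_mul, sub_sub_sub_cancel_right]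
      exact abs_birkhoffSum_gaussPsi_sub_le hx hy
  obtain ⟨δ₁, hδ₁, B₁, hB₁, h₁⟩ := hLD 1 (by simp)
  obtain ⟨δ₂, hδ₂, B₂, hB₂, h₂⟩ := hLD (-1) (by simp)
  refine ⟨min δ₁ δ₂ / 2, half_pos (lt_min hδ₁ hδ₂), exists_forall_ge_le_exp
    (ENNReal.add_ne_top.2 ⟨hB₁, hB₂⟩) (lt_min hδ₁ hδ₂) fun n => ?_⟩
  have hsub : {x | (n : ℝ) * ε ≤ |birkhoff gaussPsi n x + (n : ℝ) * (-m)|} ⊆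
      {x | n * ε ≤ 1 * (birkhoffSum gaussMap gaussPsi n x - n * m)} ∪
        {x | n * ε ≤ -1 * (birkhoffSum gaussMap gaussPsi n x - n * m)} := by
    intro x hx
    have hx' : n * ε ≤ |birkhoffSum gaussMap gaussPsi n x - n * m| := by
      rw [sub_eq_add_neg, ← mul_neg]
      exact hx
    rcases le_abs.1 hx' with h | h
    · exact Or.inl (by rwa [mem_ofPred_eq, one_mul])
    · exact Or.inr (by rwa [mem_ofPred_eq, neg_one_mul])
  refine (measure_mono hsub).trans ((measure_union_le _ _).trans ?_)
  rw [add_mul]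
  refine add_le_add ((h₁ n).trans ?_) ((h₂ n).trans ?_)
  · gcongr
    exact min_le_left _ _
  · gcongr
    exact min_le_right _ _
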